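/- The set S of symmetric rational functions of the form R(z_1,...,z_k) = r(z_1,...,z_k)/∏_{1≤i≠j≤k}(z_i - z_j q), where r is a symmetric Laurent polynomial satisfying the wheel condition r|_{z_1 = q1 z_2, z_2 = q2 z_3, z_3 = z_1/q ... i.e. {z1/z2, z2/z3, z3/z1} = {q1, q2, 1/q}} = 0, is closed under the shuffle product: if R and R' lie in S then so does R * R'. -/

import Mathlib

open MvPolynomial

variable {K : Type*} [Field K]

/-- The wheel conditions for a (Laurent) polynomial numerator r in k variables:
r vanishes whenever {z_a/z_b, z_b/z_c, z_c/z_a} = {q1, q2, 1/q} (both the q1-first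
and the q2-first orderings), i.e. under the substitutions
z_a ↦ q1q2 z_c, z_b ↦ q2 z_c and z_a ↦ q1q2 z_c, z_b ↦ q1 z_c. -/
def wheelCond (q1 q2 : K) {k : ℕ} (p : MvPolynomial (Fin k) K) : Prop :=
  ∀ a b c : Fin k, a ≠ b → b ≠ c → a ≠ c →
    (aeval (fun m => if m = a then C (q1 * q2) * X c
        else if m = b then C q2 * X c else X m) p = 0) ∧
    (aeval (fun m => if m = a then C (q1 * q2) * X c
        else if m = b then C q1 * X c else X m) p = 0)

/-- Symmetry of a polynomial under all permutations of the variables. -/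
def isSymmPoly {k : ℕ} (p : MvPolynomial (Fin k) K) : Prop :=
  ∀ σ : Equiv.Perm (Fin k), rename σ p = p

/-- The denominator ∏_{1 ≤ i ≠ j ≤ k} (z_i - z_j q), together with a factor
(z_1 ⋯ z_k)^d clearing the Laurent part of the numerator. -/
noncomputable def shufDen (q1 q2 : K) (k : ℕ) (d : ℕ) : MvPolynomial (Fin k) K :=
  (∏ i : Fin k, X i) ^ d *
    ∏ pr ∈ Finset.univ.filter (fun pr : Fin k × Fin k => pr.1 ≠ pr.2),
      (X pr.1 - C (q1 * q2) * X pr.2)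


section Helpers

/-- Substitution `X j := X i`. -/
noncomputable def substVar {n : ℕ} (i j : Fin n) :
    MvPolynomial (Fin n) K →ₐ[K] MvPolynomial (Fin n) K :=
  aeval (fun m => if m = j then X i else X m)

lemma dvd_iff_substVar {n : ℕ} (i j : Fin n) (f : MvPolynomial (Fin n) K) :
    (X j - X i) ∣ f ↔ substVar i j f = 0 := by
  constructor
  · rintro ⟨g, rfl⟩
    rw [map_mul]
    have : substVar i j (X j - X i : MvPolynomial (Fin n) K) = 0 := by
      simp [substVar]
    rw [this, zero_mul]
  · intro h
    let I : Ideal (MvPolynomial (Fin n) K) := Ideal.span {X j - X i}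
    have e : (Ideal.Quotient.mkₐ K I).comp (substVar i j) = Ideal.Quotient.mkₐ K I := by
      apply MvPolynomial.algHom_ext
      intro m
      simp only [substVar, AlgHom.comp_apply, aeval_X]
      split_ifs with hm
      · subst hm
        simp only [Ideal.Quotient.mkₐ_eq_mk]
        rw [Ideal.Quotient.eq, ← neg_sub]
        exact I.neg_mem (Ideal.mem_span_singleton_self _)
      · rfl
    have e2 := DFunLike.congr_fun e f
    rw [AlgHom.comp_apply, h, map_zero] at e2
    rw [← Ideal.mem_span_singleton]
    exact Ideal.Quotient.eq_zero_iff_mem.mp e2.symm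

lemma X_sub_smul_ne_zero {n : ℕ} {i j : Fin n} (h : i ≠ j) (c : K) :
    (X i - C c * X j : MvPolynomial (Fin n) K) ≠ 0 := by
  intro h0
  have := congrArg (aeval (fun m => if m = i then (1 : K) else 0)) h0
  simp [h.symm] at this

lemma X_sub_X_ne_zero {n : ℕ} {i j : Fin n} (h : i ≠ j) :
    (X i - X j : MvPolynomial (Fin n) K) ≠ 0 := by
  simpa using X_sub_smul_ne_zero (K := K) h 1

lemma prime_X_sub_X {n : ℕ} {i j : Fin n} (h : i ≠ j) :
    Prime (X j - X i : MvPolynomial (Fin n) K) := by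
  refine ⟨X_sub_X_ne_zero h.symm, ?_, ?_⟩
  · intro hu
    have := (dvd_iff_substVar i j (1 : MvPolynomial (Fin n) K)).mp hu.dvd
    simp at this
  · intro a b hab
    rw [dvd_iff_substVar] at hab ⊢
    rw [dvd_iff_substVar]
    rw [map_mul] at hab
    exact mul_eq_zero.mp hab

/-- The Vandermonde determinant in the variables. -/
noncomputable def vdm (K : Type*) [Field K] (n : ℕ) : MvPolynomial (Fin n) K :=
  (Matrix.vandermonde (fun i : Fin n => (X i : MvPolynomial (Fin n) K))).det

lemma vdm_eq (n : ℕ) : vdm K n = ∏ i : Fin n, ∏ j ∈ Finset.Ioi i, (X j - X i) :=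
  Matrix.det_vandermonde _

lemma rename_vdm {n : ℕ} (σ : Equiv.Perm (Fin n)) :
    rename σ (vdm K n) = (Equiv.Perm.sign σ : ℤ) * vdm K n := by
  unfold vdm
  rw [← Matrix.det_permute, AlgHom.map_det]
  congr 1
  ext i j : 1
  simp [Matrix.vandermonde_apply]

lemma sign_sq {R : Type*} [CommRing R] {n : ℕ} (σ : Equiv.Perm (Fin n)) :
    (((Equiv.Perm.sign σ : ℤ) : R)) * ((Equiv.Perm.sign σ : ℤ) : R) = 1 := by
  rw [← Int.cast_mul, ← Units.val_mul, Int.units_mul_self]; simp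

lemma map_vdm_ne_zero {n : ℕ} (φ : MvPolynomial (Fin n) K →ₐ[K] MvPolynomial (Fin n) K)
    (h : ∀ i j : Fin n, i < j → φ (X j) ≠ φ (X i)) : φ (vdm K n) ≠ 0 := by
  rw [vdm_eq, map_prod, Finset.prod_ne_zero_iff]
  intro i _
  rw [map_prod, Finset.prod_ne_zero_iff]
  intro j hj
  rw [map_sub, sub_ne_zero]
  exact h i j (by simpa using hj)

lemma vdm_ne_zero (n : ℕ) : vdm K n ≠ 0 := by
  have := map_vdm_ne_zero (AlgHom.id K (MvPolynomial (Fin n) K))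
    (fun i j hij => by simpa using hij.ne')
  simpa using this

lemma vdm_dvd {n : ℕ} (f : MvPolynomial (Fin n) K)
    (h : ∀ i j : Fin n, i ≠ j → (X j - X i) ∣ f) : vdm K n ∣ f := by
  rw [vdm_eq, Finset.prod_sigma']
  apply Finset.prod_dvd_of_isRelPrime
  · rintro ⟨i, j⟩ hij ⟨a, b⟩ hab hne
    have hij' : i < j := by simpa using hij
    have hab' : a < b := by simpa using hab
    simp only [Function.onFun]
    rw [(prime_X_sub_X hij'.ne).irreducible.isRelPrime_iff_not_dvd, dvd_iff_substVar]
    simp only [substVar, map_sub, aeval_X]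
    have hne' : ¬ (i = a ∧ j = b) := by
      rintro ⟨rfl, rfl⟩; exact hne rfl
    split_ifs with h1 h2 h2
    · omega
    · subst h1
      exact X_sub_X_ne_zero (by rintro rfl; exact hne' ⟨rfl, rfl⟩)
    · subst h2
      exact X_sub_X_ne_zero (by omega)
    · exact X_sub_X_ne_zero (by omega)
  · rintro ⟨i, j⟩ hij
    have hij' : i < j := by simpa using hij
    exact h i j hij'.ne

/-- Antisymmetrization. -/
noncomputable def asym {n : ℕ} (f : MvPolynomial (Fin n) K) : MvPolynomial (Fin n) K :=
  ∑ σ : Equiv.Perm (Fin n), ((Equiv.Perm.sign σ : ℤ) : MvPolynomial (Fin n) K) * rename σ f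

lemma rename_asym {n : ℕ} (τ : Equiv.Perm (Fin n)) (f : MvPolynomial (Fin n) K) :
    rename τ (asym f) = ((Equiv.Perm.sign τ : ℤ) : MvPolynomial (Fin n) K) * asym f := by
  unfold asym
  rw [map_sum, Finset.mul_sum]
  symm
  rw [← Equiv.sum_comp (Equiv.mulLeft τ)]
  refine Finset.sum_congr rfl fun σ _ => ?_
  rw [map_mul, rename_rename, map_intCast]
  simp only [Equiv.coe_mulLeft, Equiv.Perm.sign_mul, Units.val_mul, Int.cast_mul,
    Equiv.Perm.coe_mul]
  rw [← mul_assoc, ← mul_assoc, sign_sq, one_mul]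

lemma vdm_dvd_asym [CharZero K] {n : ℕ} (f : MvPolynomial (Fin n) K) : vdm K n ∣ asym f := by
  apply vdm_dvd
  intro i j hij
  rw [dvd_iff_substVar]
  have h1 := rename_asym (Equiv.swap i j) f
  rw [Equiv.Perm.sign_swap hij] at h1
  have h2 : (substVar i j).comp (rename (Equiv.swap i j)) = substVar (K := K) i j := by
    apply MvPolynomial.algHom_ext
    intro m
    simp only [substVar, AlgHom.comp_apply, rename_X, aeval_X]
    rw [Equiv.swap_apply_def]
    split_ifs <;> simp_all
  have h3 := DFunLike.congr_fun h2 (asym f)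
  rw [AlgHom.comp_apply, h1] at h3
  simp only [Units.val_neg, Units.val_one, Int.cast_neg, Int.cast_one, neg_mul, one_mul,
    map_neg] at h3
  exact self_eq_neg.mp h3.symm

/-- Cross difference product. -/
noncomputable def crossProd {k k' : ℕ}
    (h : MvPolynomial (Fin (k + k')) K → MvPolynomial (Fin (k + k')) K →
      MvPolynomial (Fin (k + k')) K) : MvPolynomial (Fin (k + k')) K :=
  ∏ i : Fin k, ∏ j : Fin k', h (X (Fin.castAdd k' i)) (X (Fin.natAdd k j))

lemma cross_dvd_vdm (k k' : ℕ) :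
    crossProd (K := K) (k := k) (k' := k') (fun x y => y - x) ∣ vdm K (k + k') := by
  rw [vdm_eq, Fin.prod_univ_add]
  apply Dvd.dvd.mul_right
  apply Finset.prod_dvd_prod_of_dvd
  intro i _
  have := Finset.prod_map (Finset.univ : Finset (Fin k')) (Fin.natAddEmb k)
    (fun m => (X m - X (Fin.castAdd k' i) : MvPolynomial (Fin (k + k')) K))
  simp only [Fin.natAddEmb_apply] at this
  rw [← this]
  apply Finset.prod_dvd_prod_of_subset
  intro m hm
  simp only [Finset.mem_map, Finset.mem_univ, true_and, Fin.natAddEmb_apply] at hm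
  obtain ⟨j, rfl⟩ := hm
  simp [Fin.lt_def]
  omega

/-- The wheel substitution. -/
noncomputable def wheelSub {n : ℕ} (q1 q2 : K) (a b c : Fin n) :
    MvPolynomial (Fin n) K →ₐ[K] MvPolynomial (Fin n) K :=
  aeval (fun m => if m = a then C (q1 * q2) * X c else if m = b then C q2 * X c else X m)

lemma wheelCond_iff {n : ℕ} (q1 q2 : K) (p : MvPolynomial (Fin n) K) :
    wheelCond q1 q2 p ↔ ∀ a b c : Fin n, a ≠ b → b ≠ c → a ≠ c →
      wheelSub q1 q2 a b c p = 0 ∧ wheelSub q2 q1 a b c p = 0 := by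
  unfold wheelCond wheelSub
  rw [mul_comm q2 q1]

lemma wheelSub_rename {m n : ℕ} (f : Fin m → Fin n) (hf : Function.Injective f) (q1 q2 : K)
    (a b c : Fin m) (p : MvPolynomial (Fin m) K) :
    wheelSub q1 q2 (f a) (f b) (f c) (rename f p) = rename f (wheelSub q1 q2 a b c p) := by
  rw [← AlgHom.comp_apply, ← AlgHom.comp_apply]
  congr 1
  apply MvPolynomial.algHom_ext
  intro i
  simp only [wheelSub, AlgHom.comp_apply, rename_X, aeval_X, hf.eq_iff]
  split_ifs <;> simp

/-- The numerator attached to a cross factor `h`. -/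
noncomputable def numer {k k' : ℕ} (p : MvPolynomial (Fin k) K) (p' : MvPolynomial (Fin k') K)
    (d d' : ℕ) (h : MvPolynomial (Fin (k + k')) K → MvPolynomial (Fin (k + k')) K →
      MvPolynomial (Fin (k + k')) K) : MvPolynomial (Fin (k + k')) K :=
  (∏ i : Fin k, X (Fin.castAdd k' i)) ^ d' * (∏ j : Fin k', X (Fin.natAdd k j)) ^ d *
    rename (Fin.castAdd k') p * rename (Fin.natAdd k) p' * crossProd h

lemma numer_wheel {k k' : ℕ} (q1 q2 : K) (p : MvPolynomial (Fin k) K)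
    (p' : MvPolynomial (Fin k') K) (d d' : ℕ)
    (h : MvPolynomial (Fin (k + k')) K → MvPolynomial (Fin (k + k')) K →
      MvPolynomial (Fin (k + k')) K)
    (hh : ∀ (ψ : MvPolynomial (Fin (k + k')) K →ₐ[K] MvPolynomial (Fin (k + k')) K) x y,
      ψ (h x y) = h (ψ x) (ψ y))
    (hw : wheelCond q1 q2 p) (hw' : wheelCond q1 q2 p')
    (a b c : Fin (k + k')) (hab : a ≠ b) (hbc : b ≠ c) (hac : a ≠ c)
    (H : ∀ s : Fin (k + k') → Prop, ¬ (s a ∧ s b ∧ s c) → (s a ∨ s b ∨ s c) →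
      ∃ i j, s i ∧ ¬ s j ∧
        h (wheelSub q1 q2 a b c (X i)) (wheelSub q1 q2 a b c (X j)) = 0)
    (σ : Equiv.Perm (Fin (k + k'))) :
    wheelSub q1 q2 a b c (rename σ (numer p p' d d' h)) = 0 := by
  rw [wheelCond_iff] at hw hw'
  have inj1 : Function.Injective (fun i : Fin k => σ (Fin.castAdd k' i)) :=
    σ.injective.comp (Fin.castAdd_injective _ _)
  have inj2 : Function.Injective (fun i : Fin k' => σ (Fin.natAdd k i)) :=
    σ.injective.comp (Fin.natAdd_injective _ _)
  have key : ∀ m, (∃ i : Fin k, σ (Fin.castAdd k' i) = m) ∨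
      (∃ j : Fin k', σ (Fin.natAdd k j) = m) := by
    intro m
    obtain ⟨m', rfl⟩ := σ.surjective m
    refine Fin.addCases (fun i => Or.inl ⟨i, rfl⟩) (fun j => Or.inr ⟨j, rfl⟩) m'
  have key2 : ∀ m, ¬ (∃ i : Fin k, σ (Fin.castAdd k' i) = m) →
      (∃ j : Fin k', σ (Fin.natAdd k j) = m) := fun m hm => (key m).resolve_left hm
  unfold numer
  simp only [map_mul, rename_rename]
  by_cases h1 : (∃ i : Fin k, σ (Fin.castAdd k' i) = a) ∧ (∃ i : Fin k, σ (Fin.castAdd k' i) = b)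
      ∧ (∃ i : Fin k, σ (Fin.castAdd k' i) = c)
  · obtain ⟨⟨a, rfl⟩, ⟨b, rfl⟩, ⟨c, rfl⟩⟩ := h1
    have := wheelSub_rename _ inj1 q1 q2 a b c p
    rw [(hw a b c (by rintro rfl; exact hab rfl) (by rintro rfl; exact hbc rfl)
      (by rintro rfl; exact hac rfl)).1, map_zero] at this
    simp only [Function.comp_def]
    rw [this]; ring
  by_cases h2 : (∃ i : Fin k, σ (Fin.castAdd k' i) = a) ∨ (∃ i : Fin k, σ (Fin.castAdd k' i) = b)
      ∨ (∃ i : Fin k, σ (Fin.castAdd k' i) = c)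
  · obtain ⟨i, j, ⟨i, rfl⟩, hj, h0⟩ := H (fun m => ∃ i : Fin k, σ (Fin.castAdd k' i) = m) h1 h2
    obtain ⟨j, rfl⟩ := key2 j hj
    have : wheelSub q1 q2 a b c (rename σ (crossProd h)) = 0 := by
      unfold crossProd
      rw [map_prod, map_prod]
      apply Finset.prod_eq_zero (Finset.mem_univ i)
      rw [map_prod, map_prod]
      apply Finset.prod_eq_zero (Finset.mem_univ j)
      rw [hh, hh, rename_X, rename_X, h0]
    rw [this]; ring
  · push Not at h2
    obtain ⟨a, rfl⟩ := key2 a (by simpa using h2.1)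
    obtain ⟨b, rfl⟩ := key2 b (by simpa using h2.2.1)
    obtain ⟨c, rfl⟩ := key2 c (by simpa using h2.2.2)
    have := wheelSub_rename _ inj2 q1 q2 a b c p'
    rw [(hw' a b c (by rintro rfl; exact hab rfl) (by rintro rfl; exact hbc rfl)
      (by rintro rfl; exact hac rfl)).1, map_zero] at this
    simp only [Function.comp_def]
    rw [this]; ring


lemma comb_cycle {α : Type*} (a b c : α) (s : α → Prop) (R : α → α → Prop)
    (hs1 : ¬ (s a ∧ s b ∧ s c)) (hs2 : s a ∨ s b ∨ s c)
    (h1 : R b a) (h2 : R c b) (h3 : R a c) : ∃ i j, s i ∧ ¬ s j ∧ R i j := by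
  by_cases sa : s a
  · by_cases sc : s c
    · exact ⟨c, b, sc, fun sb => hs1 ⟨sa, sb, sc⟩, h2⟩
    · exact ⟨a, c, sa, sc, h3⟩
  · by_cases sb : s b
    · exact ⟨b, a, sb, sa, h1⟩
    · exact ⟨c, b, by tauto, sb, h2⟩

lemma comb_star {α : Type*} (a b c : α) (s : α → Prop) (R : α → α → Prop)
    (hs1 : ¬ (s a ∧ s b ∧ s c)) (hs2 : s a ∨ s b ∨ s c)
    (h1 : R b a) (h2 : R a b) (h3 : R b c) (h4 : R c b) : ∃ i j, s i ∧ ¬ s j ∧ R i j := by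
  by_cases sb : s b
  · by_cases sa : s a
    · exact ⟨b, c, sb, fun sc => hs1 ⟨sa, sb, sc⟩, h3⟩
    · exact ⟨b, a, sb, sa, h1⟩
  · by_cases sa : s a
    · exact ⟨a, b, sa, sb, h2⟩
    · exact ⟨c, b, by tauto, sb, h4⟩


/-- The off-diagonal product. -/
noncomputable def offProd (q : K) (n : ℕ) : MvPolynomial (Fin n) K :=
  ∏ i : Fin n, ∏ j : Fin n, if i = j then 1 else (X i - C q * X j)

lemma shufDen_eq (q1 q2 : K) (n d : ℕ) :
    shufDen q1 q2 n d = (∏ i : Fin n, X i) ^ d * offProd (q1 * q2) n := by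
  unfold shufDen offProd
  rw [Finset.prod_filter, Fintype.prod_prod_type]
  congr 1
  refine Finset.prod_congr rfl fun i _ => Finset.prod_congr rfl fun j _ => ?_
  by_cases h : i = j <;> simp [h]

lemma rename_offProd {n : ℕ} (q : K) (σ : Equiv.Perm (Fin n)) :
    rename σ (offProd q n) = offProd q n := by
  unfold offProd
  simp only [map_prod]
  symm
  rw [← Equiv.prod_comp σ]
  refine Finset.prod_congr rfl fun i _ => ?_
  rw [← Equiv.prod_comp σ]
  refine Finset.prod_congr rfl fun j _ => ?_
  by_cases h : i = j <;> simp [h]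

lemma rename_prodX {n : ℕ} (σ : Equiv.Perm (Fin n)) :
    rename σ (∏ i : Fin n, (X i : MvPolynomial (Fin n) K)) = ∏ i : Fin n, X i := by
  rw [map_prod]
  simp only [rename_X]
  exact Equiv.prod_comp σ (fun i => (X i : MvPolynomial (Fin n) K))

lemma offProd_ne_zero (q : K) (n : ℕ) : offProd q n ≠ 0 := by
  unfold offProd
  rw [Finset.prod_ne_zero_iff]; intro i _
  rw [Finset.prod_ne_zero_iff]; intro j _
  split_ifs with h
  · exact one_ne_zero
  · exact X_sub_smul_ne_zero h q

lemma shufDen_ne_zero (q1 q2 : K) (n d : ℕ) : shufDen q1 q2 n d ≠ 0 := by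
  rw [shufDen_eq]
  refine mul_ne_zero (pow_ne_zero _ ?_) (offProd_ne_zero _ _)
  rw [Finset.prod_ne_zero_iff]
  exact fun i _ => X_ne_zero i

lemma offProd_add (q : K) (k k' : ℕ) :
    offProd q (k + k') = rename (Fin.castAdd k') (offProd q k) *
      rename (Fin.natAdd k) (offProd q k') *
      crossProd (fun x y => (x - C q * y) * (y - C q * x)) := by
  have h1 : ∀ (i : Fin k) (j : Fin k'), Fin.castAdd k' i ≠ Fin.natAdd k j := by
    intro i j h
    have := congrArg Fin.val h
    simp at this
    omega
  have h2 := fun i j => (h1 i j).symm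
  unfold offProd crossProd
  rw [Fin.prod_univ_add]
  simp only [Fin.prod_univ_add, h1, h2, if_false, map_prod, Finset.prod_mul_distrib]
  rw [Finset.prod_comm (s := (Finset.univ : Finset (Fin k'))) (t := (Finset.univ : Finset (Fin k)))]
  have e1 : ∀ i j : Fin k, rename (Fin.castAdd k')
      (if i = j then 1 else (X i - C q * X j) : MvPolynomial (Fin k) K) =
      if Fin.castAdd k' i = Fin.castAdd k' j then 1 else
        (X (Fin.castAdd k' i) - C q * X (Fin.castAdd k' j)) := by
    intro i j
    by_cases h : i = j <;> simp [h]
  have e2 : ∀ i j : Fin k', rename (Fin.natAdd k)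
      (if i = j then 1 else (X i - C q * X j) : MvPolynomial (Fin k') K) =
      if Fin.natAdd k i = Fin.natAdd k j then 1 else
        (X (Fin.natAdd k i) - C q * X (Fin.natAdd k j)) := by
    intro i j
    by_cases h : i = j <;> simp [h]
  simp only [e1, e2]
  ring

/-- The cross factor. -/
noncomputable def crossE {n : ℕ} (q1 q2 : K) (x y : MvPolynomial (Fin n) K) :
    MvPolynomial (Fin n) K :=
  (y - C q1 * x) * (y - C q2 * x) * (x - C (q1 * q2) * y)

lemma crossE_comm {n : ℕ} (q1 q2 : K) : crossE (n := n) q1 q2 = crossE q2 q1 := by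
  funext x y
  unfold crossE
  rw [mul_comm q1 q2]; ring

lemma crossProd_mul {k k' : ℕ} (f g : MvPolynomial (Fin (k + k')) K →
    MvPolynomial (Fin (k + k')) K → MvPolynomial (Fin (k + k')) K) :
    crossProd (fun x y => f x y * g x y) = crossProd f * crossProd g := by
  simp only [crossProd, Finset.prod_mul_distrib]

lemma wheelSub_X {n : ℕ} (q1 q2 : K) {a b c : Fin n} (hab : a ≠ b) (hbc : b ≠ c) (hac : a ≠ c) :
    wheelSub q1 q2 a b c (X a) = C q1 * C q2 * X c ∧
    wheelSub q1 q2 a b c (X b) = C q2 * X c ∧ wheelSub q1 q2 a b c (X c) = X c := by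
  simp [wheelSub, hab.symm, hbc.symm, hac.symm]

/-- Degenerate case: the cross factor is divisible by `y - x`. -/
lemma quot_wheel_deg {k k' : ℕ} (q1 q2 : K) (p : MvPolynomial (Fin k) K)
    (p' : MvPolynomial (Fin k') K) (d d' : ℕ)
    (hw : wheelCond q1 q2 p) (hw' : wheelCond q1 q2 p')
    (W r : MvPolynomial (Fin (k + k')) K)
    (hW : vdm K (k + k') = crossProd (fun x y => y - x) * W)
    (hr : asym (numer p p' d d' (crossE q1 q2) * W) = vdm K (k + k') * r)
    (a b c : Fin (k + k')) (hab : a ≠ b) (hbc : b ≠ c) (hac : a ≠ c)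
    (g : MvPolynomial (Fin (k + k')) K → MvPolynomial (Fin (k + k')) K →
      MvPolynomial (Fin (k + k')) K)
    (hg : ∀ x y, crossE q1 q2 x y = (y - x) * g x y)
    (hh : ∀ (ψ : MvPolynomial (Fin (k + k')) K →ₐ[K] MvPolynomial (Fin (k + k')) K) x y,
      ψ (g x y) = g (ψ x) (ψ y))
    (H : ∀ s : Fin (k + k') → Prop, ¬ (s a ∧ s b ∧ s c) → (s a ∨ s b ∨ s c) →
      ∃ i j, s i ∧ ¬ s j ∧
        g (wheelSub q1 q2 a b c (X i)) (wheelSub q1 q2 a b c (X j)) = 0) :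
    wheelSub q1 q2 a b c r = 0 := by
  have e : numer p p' d d' (crossE q1 q2) * W = numer p p' d d' g * vdm K (k + k') := by
    have : (crossE q1 q2 : MvPolynomial (Fin (k + k')) K → _) =
      fun x y => (y - x) * g x y := by funext x y; exact hg x y
    rw [hW, this]
    unfold numer
    rw [crossProd_mul]
    ring
  have e2 : r = ∑ σ : Equiv.Perm (Fin (k + k')), rename σ (numer p p' d d' g) := by
    apply mul_left_cancel₀ (vdm_ne_zero (K := K) (k + k'))
    rw [← hr, e, asym, Finset.mul_sum]
    refine Finset.sum_congr rfl fun σ _ => ?_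
    rw [map_mul, rename_vdm]
    linear_combination (rename σ (numer p p' d d' g) * vdm K (k + k')) *
      (sign_sq (R := MvPolynomial (Fin (k + k')) K) σ)
  rw [e2, map_sum]
  exact Finset.sum_eq_zero fun σ _ =>
    numer_wheel q1 q2 p p' d d' g hh hw hw' a b c hab hbc hac H σ

lemma alg_C {n : ℕ} (ψ : MvPolynomial (Fin n) K →ₐ[K] MvPolynomial (Fin n) K) (c : K) :
    ψ (C c) = C c := ψ.commutes c

lemma quot_wheel {k k' : ℕ} (q1 q2 : K) (hq : q1 * q2 ≠ 0) (p : MvPolynomial (Fin k) K)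
    (p' : MvPolynomial (Fin k') K) (d d' : ℕ)
    (hw : wheelCond q1 q2 p) (hw' : wheelCond q1 q2 p')
    (W r : MvPolynomial (Fin (k + k')) K)
    (hW : vdm K (k + k') = crossProd (fun x y => y - x) * W)
    (hr : asym (numer p p' d d' (crossE q1 q2) * W) = vdm K (k + k') * r)
    (a b c : Fin (k + k')) (hab : a ≠ b) (hbc : b ≠ c) (hac : a ≠ c) :
    wheelSub q1 q2 a b c r = 0 := by
  obtain ⟨ea, eb, ec⟩ := wheelSub_X q1 q2 hab hbc hac
  by_cases h1 : q1 = 1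
  · subst h1
    refine quot_wheel_deg 1 q2 p p' d d' hw hw' W r hW hr a b c hab hbc hac
      (fun x y => (y - C q2 * x) * (x - C q2 * y)) ?_ ?_ ?_
    · intro x y; simp [crossE]; ring
    · intro ψ x y; simp only [map_mul, map_sub, alg_C]
    · intro s hs1 hs2
      have z1 : ∀ x y, (x = a ∧ y = c ∨ x = c ∧ y = a ∨ x = b ∧ y = c ∨ x = c ∧ y = b) →
          (fun x y => (y - C q2 * x) * (x - C q2 * y)) (wheelSub 1 q2 a b c (X x))
            (wheelSub 1 q2 a b c (X y)) = 0 := by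
        rintro x y (⟨rfl, rfl⟩ | ⟨rfl, rfl⟩ | ⟨rfl, rfl⟩ | ⟨rfl, rfl⟩) <;>
          simp [ea, eb, ec]
      refine comb_star a c b s (fun i j => (fun x y => (y - C q2 * x) * (x - C q2 * y))
        (wheelSub 1 q2 a b c (X i)) (wheelSub 1 q2 a b c (X j)) = 0) (by tauto) (by tauto)
        ?_ ?_ ?_ ?_ <;> exact z1 _ _ (by simp)
  by_cases h2 : q2 = 1
  · subst h2
    refine quot_wheel_deg q1 1 p p' d d' hw hw' W r hW hr a b c hab hbc hac
      (fun x y => (y - C q1 * x) * (x - C q1 * y)) ?_ ?_ ?_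
    · intro x y; simp [crossE]; ring
    · intro ψ x y; simp only [map_mul, map_sub, alg_C]
    · intro s hs1 hs2
      have z1 : ∀ x y, (x = a ∧ y = c ∨ x = c ∧ y = a ∨ x = a ∧ y = b ∨ x = b ∧ y = a) →
          (fun x y => (y - C q1 * x) * (x - C q1 * y)) (wheelSub q1 1 a b c (X x))
            (wheelSub q1 1 a b c (X y)) = 0 := by
        rintro x y (⟨rfl, rfl⟩ | ⟨rfl, rfl⟩ | ⟨rfl, rfl⟩ | ⟨rfl, rfl⟩) <;>
          simp [ea, eb, ec]
      refine comb_star b a c s (fun i j => (fun x y => (y - C q1 * x) * (x - C q1 * y))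
        (wheelSub q1 1 a b c (X i)) (wheelSub q1 1 a b c (X j)) = 0) (by tauto) (by tauto)
        ?_ ?_ ?_ ?_ <;> exact z1 _ _ (by simp)
  by_cases h3 : q1 * q2 = 1
  · have h3' : (C q1 * C q2 : MvPolynomial (Fin (k + k')) K) = 1 := by
      rw [← C_mul, h3, C_1]
    refine quot_wheel_deg q1 q2 p p' d d' hw hw' W r hW hr a b c hab hbc hac
      (fun x y => - ((y - C q1 * x) * (y - C q2 * x))) ?_ ?_ ?_
    · intro x y; simp [crossE, h3']; ring
    · intro ψ x y; simp only [map_mul, map_sub, map_neg, alg_C]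
    · intro s hs1 hs2
      have z1 : ∀ x y, (x = a ∧ y = b ∨ x = b ∧ y = a ∨ x = b ∧ y = c ∨ x = c ∧ y = b) →
          (fun x y => - ((y - C q1 * x) * (y - C q2 * x))) (wheelSub q1 q2 a b c (X x))
            (wheelSub q1 q2 a b c (X y)) = 0 := by
        rintro x y (⟨rfl, rfl⟩ | ⟨rfl, rfl⟩ | ⟨rfl, rfl⟩ | ⟨rfl, rfl⟩) <;>
          simp only [ea, eb, ec] <;> grind
      refine comb_star a b c s (fun i j => (fun x y => - ((y - C q1 * x) * (y - C q2 * x)))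
        (wheelSub q1 q2 a b c (X i)) (wheelSub q1 q2 a b c (X j)) = 0) hs1 hs2
        ?_ ?_ ?_ ?_ <;> exact z1 _ _ (by simp)
  have hv : wheelSub q1 q2 a b c (vdm K (k + k')) ≠ 0 := by
    apply map_vdm_ne_zero
    have h10 : q1 ≠ 0 := left_ne_zero_of_mul hq
    have h20 : q2 ≠ 0 := right_ne_zero_of_mul hq
    intro i j hij he
    have := congrArg (fun f => fun v : Fin (k + k') → K => MvPolynomial.eval v f) he
    simp only [wheelSub, aeval_X] at this
    have t1 := congrFun this (fun _ => 1)
    have t2 := congrFun this (fun m => if m = i then 1 else 0)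
    have t3 := congrFun this (fun m => if m = j then 1 else 0)
    clear hw hw' hW hr ea eb ec this he
    split_ifs at t1 t2 t3 <;> simp at t1 t2 t3 <;> grind
  have := congrArg (wheelSub q1 q2 a b c) hr
  rw [map_mul] at this
  refine (mul_eq_zero.mp (this.symm.trans ?_)).resolve_left hv
  rw [asym, map_sum]
  refine Finset.sum_eq_zero fun σ _ => ?_
  rw [map_mul, map_mul, map_mul, numer_wheel q1 q2 p p' d d' (crossE q1 q2) ?_ hw hw' a b c hab
    hbc hac ?_ σ]
  · ring
  · intro ψ x y; simp only [crossE, map_mul, map_sub, alg_C]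
  · intro s hs1 hs2
    have z1 : ∀ x y, (x = b ∧ y = a ∨ x = c ∧ y = b ∨ x = a ∧ y = c) →
        crossE q1 q2 (wheelSub q1 q2 a b c (X x))
          (wheelSub q1 q2 a b c (X y)) = 0 := by
      rintro x y (⟨rfl, rfl⟩ | ⟨rfl, rfl⟩ | ⟨rfl, rfl⟩) <;>
        simp only [ea, eb, ec, crossE, C_mul] <;> ring
    refine comb_cycle a b c s (fun i j => crossE q1 q2
        (wheelSub q1 q2 a b c (X i)) (wheelSub q1 q2 a b c (X j)) = 0) hs1 hs2
        ?_ ?_ ?_ <;> exact z1 _ _ (by simp)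


lemma castAdd_ne_natAdd' {k k' : ℕ} (i : Fin k) (j : Fin k') :
    Fin.castAdd k' i ≠ Fin.natAdd k j := by
  intro h
  have := congrArg Fin.val h
  simp at this
  omega

lemma term_identity {k k' : ℕ} {L : Type*} [Field L] (q1 q2 : K)
    (ev : MvPolynomial (Fin (k + k')) K →+* L) (hev : Function.Injective ev)
    (zeta : L → L)
    (hzeta : ∀ x : L, zeta x = ((1 - x * ev (C q1)) * (1 - x * ev (C q2))) /
        ((1 - x) * (1 - x * ev (C (q1 * q2)))))
    (p : MvPolynomial (Fin k) K) (d : ℕ) (p' : MvPolynomial (Fin k') K) (d' : ℕ) :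
    (ev (rename (Fin.castAdd k') p) / ev (rename (Fin.castAdd k') (shufDen q1 q2 k d))) *
      (ev (rename (Fin.natAdd k) p') / ev (rename (Fin.natAdd k) (shufDen q1 q2 k' d'))) *
      (∏ i : Fin k, ∏ j : Fin k',
        zeta (ev (X (Fin.castAdd k' i)) / ev (X (Fin.natAdd k j)))) *
      ev (shufDen q1 q2 (k + k') (d + d' + 1)) =
    ev ((∏ i : Fin (k + k'), X i) * numer p p' d d' (crossE q1 q2)) /
      ev (crossProd (fun x y => y - x)) := by
  have ev0 : ∀ f, f ≠ 0 → ev f ≠ 0 := fun f hf => (map_ne_zero_iff ev hev).mpr hf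
  have hz : (∏ i : Fin k, ∏ j : Fin k',
        zeta (ev (X (Fin.castAdd k' i)) / ev (X (Fin.natAdd k j)))) =
      ev (crossProd (fun x y => (y - C q1 * x) * (y - C q2 * x))) /
        (ev (crossProd (fun x y => y - x)) * ev (crossProd (fun x y => y - C (q1 * q2) * x))) := by
    unfold crossProd
    simp only [map_prod, ← Finset.prod_mul_distrib, ← Finset.prod_div_distrib]
    refine Finset.prod_congr rfl fun i _ => Finset.prod_congr rfl fun j _ => ?_
    have n0 : ev (X (Fin.natAdd k j)) ≠ 0 := ev0 _ (X_ne_zero _)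
    have n1 : ev (X (Fin.natAdd k j)) - ev (X (Fin.castAdd k' i)) ≠ 0 := by
      rw [← map_sub]; exact ev0 _ (X_sub_X_ne_zero (castAdd_ne_natAdd' i j).symm)
    have n2 : ev (X (Fin.natAdd k j)) - ev (C (q1 * q2)) * ev (X (Fin.castAdd k' i)) ≠ 0 := by
      rw [← map_mul, ← map_sub]
      exact ev0 _ (X_sub_smul_ne_zero (castAdd_ne_natAdd' i j).symm _)
    rw [hzeta]
    simp only [map_mul, map_sub] at n2 ⊢
    generalize ev (X (Fin.natAdd k j)) = y at *
    generalize ev (X (Fin.castAdd k' i)) = x at *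
    have m1 : 1 - x / y = (y - x) / y := by field_simp
    have m2 : ∀ c, 1 - x / y * c = (y - c * x) / y := by intro c; field_simp
    rw [m1, m2, m2, m2]
    field_simp
  have d1 : ev (rename (Fin.castAdd k') (shufDen q1 q2 k d)) ≠ 0 :=
    ev0 _ ((map_ne_zero_iff _ (rename_injective _ (Fin.castAdd_injective _ _))).mpr
      (shufDen_ne_zero _ _ _ _))
  have d2 : ev (rename (Fin.natAdd k) (shufDen q1 q2 k' d')) ≠ 0 :=
    ev0 _ ((map_ne_zero_iff _ (rename_injective _ (Fin.natAdd_injective _ _))).mpr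
      (shufDen_ne_zero _ _ _ _))
  have d3 : ev (crossProd (fun x y => y - x)) ≠ 0 := by
    apply ev0
    intro h
    have := cross_dvd_vdm (K := K) k k'
    rw [h, zero_dvd_iff] at this
    exact vdm_ne_zero _ this
  have d4 : ev (crossProd (fun x y => y - C (q1 * q2) * x)) ≠ 0 := by
    apply ev0
    unfold crossProd
    rw [Finset.prod_ne_zero_iff]; intro i _
    rw [Finset.prod_ne_zero_iff]; intro j _
    exact X_sub_smul_ne_zero (castAdd_ne_natAdd' i j).symm _
  rw [hz]
  have hD : shufDen q1 q2 (k + k') (d + d' + 1) *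
      crossProd (fun x y => (y - C q1 * x) * (y - C q2 * x)) *
      (rename (Fin.castAdd k') p * rename (Fin.natAdd k) p') =
      ((∏ i : Fin (k + k'), X i) * numer p p' d d' (crossE q1 q2)) *
      crossProd (fun x y => y - C (q1 * q2) * x) *
      (rename (Fin.castAdd k') (shufDen q1 q2 k d) *
        rename (Fin.natAdd k) (shufDen q1 q2 k' d')) := by
    rw [shufDen_eq, shufDen_eq, shufDen_eq, offProd_add]
    have hE : (crossE q1 q2 : MvPolynomial (Fin (k + k')) K → _) =
      fun x y => ((y - C q1 * x) * (y - C q2 * x)) * (x - C (q1 * q2) * y) := rfl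
    unfold numer
    rw [hE, crossProd_mul (fun x y => x - C (q1 * q2) * y),
      crossProd_mul (fun x y => (y - C q1 * x) * (y - C q2 * x)), Fin.prod_univ_add]
    simp only [map_mul, map_pow, map_prod, rename_X]
    ring
  have hD' := congrArg ev hD
  simp only [map_mul ev] at hD' ⊢
  rw [div_mul_div_comm, div_mul_div_comm, div_mul_eq_mul_div, div_eq_div_iff
    (mul_ne_zero (mul_ne_zero d1 d2) (mul_ne_zero d3 d4)) d3]
  linear_combination (ev (crossProd (fun x y => y - x))) * hD'

end Helpers

/-- the space S of symmetric rational functions r/∏_{i≠j}(z_i - z_j q),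
with r a symmetric Laurent polynomial satisfying the wheel conditions, is closed
under the shuffle product
(R * R')(z) = (1/(k!k'!)) Sym[R(z_1..z_k) R'(z_{k+1}..z_{k+k'}) ∏_{i≤k<j} ζ(z_i/z_j)]. -/
theorem stmt_4 [CharZero K] (q1 q2 : K) (k k' : ℕ)
    (L : Type*) [Field L] [Algebra (MvPolynomial (Fin (k + k')) K) L]
    [IsFractionRing (MvPolynomial (Fin (k + k')) K) L]
    (alg : MvPolynomial (Fin (k + k')) K →+* L)
    (halg : alg = algebraMap (MvPolynomial (Fin (k + k')) K) L)
    (zeta : L → L)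
    (hzeta : ∀ x : L, zeta x = ((1 - x * alg (C q1)) * (1 - x * alg (C q2))) /
        ((1 - x) * (1 - x * alg (C (q1 * q2)))))
    (p : MvPolynomial (Fin k) K) (d : ℕ)
    (p' : MvPolynomial (Fin k') K) (d' : ℕ)
    (hp : isSymmPoly p) (hp' : isSymmPoly p')
    (hw : wheelCond q1 q2 p) (hw' : wheelCond q1 q2 p') :
    ∃ (p'' : MvPolynomial (Fin (k + k')) K) (d'' : ℕ),
      isSymmPoly p'' ∧ wheelCond q1 q2 p'' ∧
      (alg (C (((k.factorial * k'.factorial : ℕ) : K))⁻¹) *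
          ∑ σ : Equiv.Perm (Fin (k + k')),
            (alg (rename (fun i : Fin k => σ (Fin.castAdd k' i)) p) /
                alg (rename (fun i : Fin k => σ (Fin.castAdd k' i)) (shufDen q1 q2 k d))) *
            (alg (rename (fun j : Fin k' => σ (Fin.natAdd k j)) p') /
                alg (rename (fun j : Fin k' => σ (Fin.natAdd k j)) (shufDen q1 q2 k' d'))) *
            ∏ i : Fin k, ∏ j : Fin k',
              zeta (alg (X (σ (Fin.castAdd k' i))) / alg (X (σ (Fin.natAdd k j))))) *
        alg (shufDen q1 q2 (k + k') d'')
      = alg p'' := by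
  subst halg
  set alg := algebraMap (MvPolynomial (Fin (k + k')) K) L with halg
  have hinj : Function.Injective alg := IsFractionRing.injective _ L
  obtain ⟨W, hW⟩ := cross_dvd_vdm (K := K) k k'
  obtain ⟨r, hr⟩ := vdm_dvd_asym (numer p p' d d' (crossE q1 q2) * W)
  have hV : alg (vdm K (k + k')) ≠ 0 :=
    (map_ne_zero_iff alg hinj).mpr (vdm_ne_zero _)
  have hrsymm : ∀ σ : Equiv.Perm (Fin (k + k')), rename σ r = r := by
    intro σ
    have h1 := congrArg (rename σ) hr
    rw [rename_asym, map_mul, rename_vdm, hr] at h1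
    apply mul_left_cancel₀ (vdm_ne_zero (K := K) (k + k'))
    linear_combination (-((Equiv.Perm.sign σ : ℤ) : MvPolynomial (Fin (k + k')) K)) * h1 +
      (vdm K (k + k') * r - vdm K (k + k') * rename σ r) *
        (sign_sq (R := MvPolynomial (Fin (k + k')) K) σ)
  have hwsub : ∀ a b c : Fin (k + k'), a ≠ b → b ≠ c → a ≠ c → ∀ c0 : K,
      wheelSub q1 q2 a b c (C c0 * ((∏ i : Fin (k + k'), X i) * r)) = 0 ∧
      wheelSub q2 q1 a b c (C c0 * ((∏ i : Fin (k + k'), X i) * r)) = 0 := by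
    intro a b c hab hbc hac c0
    simp only [map_mul]
    by_cases hq : q1 * q2 = 0
    · have z : ∀ q1 q2 : K, q1 * q2 = 0 →
          wheelSub q1 q2 a b c (∏ i : Fin (k + k'), X i) = 0 := by
        intro q1 q2 hq
        rw [map_prod]
        apply Finset.prod_eq_zero (Finset.mem_univ a)
        simp [wheelSub, hq, ← C_mul]
      rw [z q1 q2 hq, z q2 q1 (by rw [mul_comm, hq])]
      simp
    · have sw : ∀ {n : ℕ} {f : MvPolynomial (Fin n) K}, wheelCond q1 q2 f → wheelCond q2 q1 f := by
        intro n f hf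
        rw [wheelCond_iff] at hf ⊢
        exact fun a b c x y z => (hf a b c x y z).symm
      rw [quot_wheel q1 q2 hq p p' d d' hw hw' W r hW hr a b c hab hbc hac,
        quot_wheel q2 q1 (by rwa [mul_comm]) p p' d d' (sw hw) (sw hw') W r hW
          (by rw [crossE_comm]; exact hr) a b c hab hbc hac]
      simp
  refine ⟨C (((k.factorial * k'.factorial : ℕ) : K))⁻¹ * ((∏ i : Fin (k + k'), X i) * r),
    d + d' + 1, ?_, ?_, ?_⟩
  · intro σ
    rw [map_mul, map_mul, rename_C, rename_prodX, hrsymm]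
  · rw [wheelCond_iff]
    exact fun a b c hab hbc hac => hwsub a b c hab hbc hac _
  · rw [mul_assoc, map_mul alg]
    congr 1
    rw [Finset.sum_mul, map_mul]
    have hsum : alg r = ∑ σ : Equiv.Perm (Fin (k + k')),
        alg (rename σ (numer p p' d d' (crossE q1 q2))) /
          alg (rename σ (crossProd (fun x y => y - x))) := by
      apply mul_left_cancel₀ hV
      rw [← map_mul, ← hr, asym, map_sum, Finset.mul_sum]
      refine Finset.sum_congr rfl fun σ _ => ?_
      have hc := congrArg alg (congrArg (rename σ) hW)
      rw [rename_vdm, map_mul, map_mul, map_mul, map_intCast] at hc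
      have hne : alg (rename σ (crossProd (fun x y => y - x))) ≠ 0 := by
        intro h0
        rw [h0, zero_mul] at hc
        refine (mul_ne_zero ?_ hV) hc
        exact left_ne_zero_of_mul_eq_one (sign_sq (R := L) σ)
      rw [← mul_div_assoc, eq_div_iff hne]
      simp only [map_mul, map_intCast]
      linear_combination (-(((Equiv.Perm.sign σ : ℤ) : L)) *
        alg (rename σ (numer p p' d d' (crossE q1 q2)))) * hc +
        (alg (vdm K (k + k')) * alg (rename σ (numer p p' d d' (crossE q1 q2)))) *
          sign_sq (R := L) σ
    rw [hsum, Finset.mul_sum]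
    refine Finset.sum_congr rfl fun σ _ => ?_
    have key := term_identity q1 q2
      (alg.comp (rename σ : MvPolynomial (Fin (k + k')) K →ₐ[K] _).toRingHom)
      (hinj.comp (rename_injective _ σ.injective)) zeta
      (by intro x; rw [hzeta]; simp) p d p' d'
    simp only [RingHom.comp_apply, AlgHom.toRingHom_eq_coe, RingHom.coe_coe, rename_rename,
      rename_X, Function.comp_def] at key
    rw [shufDen_eq q1 q2 (k + k'), map_mul (rename σ), map_pow, rename_prodX, rename_offProd,
      ← shufDen_eq, map_mul (rename σ), rename_prodX, map_mul alg, mul_div_assoc] at key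
    exact key
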